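/- For each integer $n \geq 1$, there is an isomorphism $W_n(\overline{R}^{\flat})[\delta_0,\delta_1,\ldots]/(p\delta_0 - \xi^p, p\delta_{m+1} - \delta_m^p)_{m \geq 0} \xrightarrow{\cong} A_{\mathrm{cris}}(R)/p^n A_{\mathrm{cris}}(R)$ sending $\delta_m$ to $\gamma^{m+1}(\xi)$, where $\gamma(x) = x^p/p$. -/

import Mathlib

/-!
Statement 13: For each `n ≥ 1` there is an isomorphism
`Wₙ(R̄^♭)[δ₀,δ₁,…]/(pδ₀ - ξ^p, pδ_{m+1} - δ_m^p) ≅ A_cris(R)/pⁿA_cris(R)`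
sending `δ_m` to `γ^{m+1}(ξ)`, where `γ(x) = x^p/p`.

Here `W` stands for `W(R̄^♭)` (a `p`-torsion free ring, perfect modulo `p`,
so that `W/pⁿW = Wₙ(R̄^♭)`), `ξ` is a nonzerodivisor generating `ker θ`, and
`A_cris(R)` is the `p`-adic completion of the divided power envelope `D` of
`W` along `(ξ)`, so that `A_cris(R)/pⁿ = D/pⁿ`.  The envelope `D` is given by
its universal property, and `γ(x) = (p-1)! ⬝ dpow_p(x)`.
-/

/-- The iterates `γ^{m+1}(ξ)` of `γ(x) = x^p/p = (p-1)! ⬝ dpow_p(x)` in a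
divided power algebra. -/
def gammaIter {D : Type} [CommRing D] {J : Ideal D} (δ : DividedPowers J)
    (p : ℕ) (x : D) : ℕ → D
  | 0 => ((p - 1).factorial : D) * δ.dpow p x
  | m + 1 => ((p - 1).factorial : D) * δ.dpow p (gammaIter δ p x m)

namespace AcrisAux
open Finset

/-- An ideal in a ring where factorials are regular has divided powers as soon as
`x ^ k` is divisible by `k!` inside the ideal. -/
theorem pd_of_divisible {R : Type} [CommRing R] (K : Ideal R)
    (hreg : ∀ (k : ℕ) (x y : R), (k.factorial : R) * x = k.factorial * y → x = y)
    (hdiv : ∀ x ∈ K, ∀ k : ℕ, k ≠ 0 → ∃ y ∈ K, (k.factorial : R) * y = x ^ k) :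
    Nonempty (DividedPowers K) := by
  classical
  have hex : ∀ (k : ℕ) (x : R), ∃ y : R, (x ∉ K → y = 0) ∧
      (x ∈ K → (k.factorial : R) * y = x ^ k) ∧ (x ∈ K → k ≠ 0 → y ∈ K) := by
    intro k x
    by_cases hx : x ∈ K
    · by_cases hk : k = 0
      · subst hk
        exact ⟨1, by simp [hx]⟩
      · obtain ⟨y, hy, h⟩ := hdiv x hx k hk
        exact ⟨y, fun h => absurd hx h, fun _ => h, fun _ _ => hy⟩
    · exact ⟨0, by simp [hx]⟩
  choose dp h0 h1 h2 using hex
  refine ⟨⟨dp, fun {n x} => h0 n x, ?_, ?_, fun {n x} hn hx => h2 n x hx hn, ?_, ?_, ?_, ?_⟩⟩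
  · intro x hx
    have := h1 0 x hx
    simpa using this
  · intro x hx
    have := h1 1 x hx
    simpa using this
  · intro n x y hx hy
    apply hreg n
    rw [h1 n _ (K.add_mem hx hy), (Commute.all _ _).add_pow', mul_sum]
    apply sum_congr rfl
    rintro ⟨i, j⟩ hij
    rw [Finset.HasAntidiagonal.mem_antidiagonal] at hij
    simp only at hij ⊢
    subst hij
    rw [← h1 i x hx, ← h1 j y hy, ← Nat.add_choose_mul_factorial_mul_factorial i j,
      ← Nat.choose_symm_add, nsmul_eq_mul]
    push_cast
    ring
  · intro n a x hx
    apply hreg n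
    rw [h1 n _ (K.mul_mem_left a hx), mul_left_comm, h1 n x hx, mul_pow]
  · intro m n x hx
    apply hreg m
    apply hreg n
    have e1 := h1 m x hx
    have e2 := h1 n x hx
    have e3 := h1 (m+n) x hx
    have e4 := Nat.add_choose_mul_factorial_mul_factorial m n
    rw [← Nat.choose_symm_add] at e4
    have e5 : (n.factorial : R) * (m.factorial * (((m+n).choose m : ℕ) * dp (m+n) x)) =
      ((m+n).choose m * m.factorial * n.factorial : ℕ) * dp (m+n) x := by push_cast; ring
    rw [e5, e4, e3, pow_add, ← e1, ← e2]; ring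
  · intro m n x hn hx
    have hy := h2 n x hx hn
    apply hreg m
    rw [h1 m _ hy]
    have key : ∀ (j : ℕ) (u v : R), ((n.factorial : R) ^ j) * u = (n.factorial : R)^j * v → u = v := by
      intro j
      induction j with
      | zero => intro u v h; simpa using h
      | succ j ih =>
        intro u v h
        apply ih
        apply hreg n
        rw [pow_succ'] at h
        simpa [mul_assoc] using h
    apply key m
    rw [← mul_pow, h1 n x hx, ← pow_mul, mul_comm n m, ← h1 (m*n) x hx, ← Nat.uniformBell_mul_eq m hn]
    push_cast
    ring

theorem div_of_span {R : Type} [CommRing R] (K : Ideal R) (S : Set R) (hK : K = Ideal.span S)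
    (hS : ∀ x ∈ S, ∀ k : ℕ, k ≠ 0 → ∃ y ∈ K, (k.factorial : R) * y = x ^ k) :
    ∀ x ∈ K, ∀ k : ℕ, k ≠ 0 → ∃ y ∈ K, (k.factorial : R) * y = x ^ k := by
  intro x hx
  have hx' : x ∈ Submodule.span R S := by rw [hK] at hx; exact hx
  clear hx
  induction hx' using Submodule.span_induction with
  | mem x h => exact hS x h
  | zero => intro k hk; exact ⟨0, K.zero_mem, by simp [hk]⟩
  | add x y hx hy ihx ihy =>
    have hxK : x ∈ K := by rw [hK]; exact hx
    have hyK : y ∈ K := by rw [hK]; exact hy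
    have ex : ∀ k, ∃ u, (k.factorial : R) * u = x ^ k ∧ (k ≠ 0 → u ∈ K) := by
      intro k
      by_cases hk : k = 0
      · subst hk; exact ⟨1, by simp⟩
      · obtain ⟨u, hu, h⟩ := ihx k hk
        exact ⟨u, h, fun _ => hu⟩
    have ey : ∀ k, ∃ u, (k.factorial : R) * u = y ^ k ∧ (k ≠ 0 → u ∈ K) := by
      intro k
      by_cases hk : k = 0
      · subst hk; exact ⟨1, by simp⟩
      · obtain ⟨u, hu, h⟩ := ihy k hk
        exact ⟨u, h, fun _ => hu⟩
    choose u hu huK using ex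
    choose v hv hvK using ey
    intro k hk
    refine ⟨∑ q ∈ antidiagonal k, u q.1 * v q.2, ?_, ?_⟩
    · apply Ideal.sum_mem
      rintro ⟨i, j⟩ hij
      rw [Finset.HasAntidiagonal.mem_antidiagonal] at hij
      simp only at hij ⊢
      by_cases hi : i = 0
      · exact K.mul_mem_left _ (hvK j (by omega))
      · exact K.mul_mem_right _ (huK i hi)
    · rw [(Commute.all _ _).add_pow', mul_sum]
      apply sum_congr rfl
      rintro ⟨i, j⟩ hij
      rw [Finset.HasAntidiagonal.mem_antidiagonal] at hij
      simp only at hij ⊢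
      subst hij
      rw [← hu i, ← hv j, ← Nat.add_choose_mul_factorial_mul_factorial i j,
      ← Nat.choose_symm_add, nsmul_eq_mul]
      push_cast
      ring
  | smul a x hx ih =>
    have hxK : x ∈ K := by rw [hK]; exact hx
    intro k hk
    obtain ⟨u, hu, h⟩ := ih k hk
    refine ⟨a ^ k * u, K.mul_mem_left _ hu, ?_⟩
    rw [smul_eq_mul, mul_pow, ← h]; ring

theorem div_of_seq {R : Type} [CommRing R] (p : ℕ) [hp : Fact p.Prime] (K : Ideal R) (s : ℕ → R)
    (hsK : ∀ m, s m ∈ K)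
    (hs : ∀ m, (p : R) * s (m + 1) = s m ^ p)
    (hunit : ∀ k : ℕ, p.Coprime k → IsUnit (k : R)) :
    ∀ k : ℕ, k ≠ 0 → ∀ m, ∃ y ∈ K, (k.factorial : R) * y = s m ^ k := by
  suffices H : ∀ k : ℕ, k ≠ 0 → ∀ m, ∃ y ∈ K, (p : R) ^ (padicValNat p k.factorial) * y = s m ^ k by
    intro k hk m
    obtain ⟨y, hy, h⟩ := H k hk m
    obtain ⟨c, hc⟩ := pow_padicValNat_dvd (p := p) (n := k.factorial)
    have hcop : p.Coprime c := by
      rw [hp.out.coprime_iff_not_dvd]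
      rintro ⟨d, rfl⟩
      apply pow_succ_padicValNat_not_dvd (p := p) (Nat.factorial_ne_zero k)
      refine ⟨d, ?_⟩
      rw [pow_succ]
      nth_rewrite 1 [hc]
      ring
    obtain ⟨w, hw⟩ := (hunit c hcop).exists_right_inv
    refine ⟨w * y, K.mul_mem_left _ hy, ?_⟩
    rw [hc]
    push_cast
    rw [← h]
    linear_combination ((p : R) ^ padicValNat p k.factorial * y) * hw
  intro k
  induction k using Nat.strong_induction_on with
  | _ k ih =>
    intro hk m
    have hv : padicValNat p k.factorial = padicValNat p (k / p).factorial + k / p := by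
      rw [← padicValNat_factorial_mul, ← padicValNat_factorial_mul_add (p := p) (k / p)
        (Nat.mod_lt k hp.out.pos), Nat.div_add_mod]
    have hsplit : s m ^ k = (p : R) ^ (k / p) * s (m+1) ^ (k / p) * s m ^ (k % p) := by
      rw [← mul_pow, hs, ← pow_mul, ← pow_add, Nat.div_add_mod]
    by_cases hq : k / p = 0
    · refine ⟨s m ^ k, K.pow_mem_of_mem (hsK m) k (by omega), ?_⟩
      rw [hv, hq]; simp
    · obtain ⟨y, hy, h⟩ := ih (k / p) (Nat.div_lt_self (by omega) hp.out.one_lt) hq (m+1)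
      refine ⟨y * s m ^ (k % p), K.mul_mem_right _ hy, ?_⟩
      rw [hsplit, ← h, hv, pow_add]; ring

/-- Twisted divided powers on a square zero ideal. -/
theorem pd_twist {C : Type} [CommRing C] (p : ℕ) [hp : Fact p.Prime] (K : Ideal C)
    (hsq : ∀ x ∈ K, ∀ y ∈ K, x * y = 0) (φ : C → C)
    (hadd : ∀ x ∈ K, ∀ y ∈ K, φ (x + y) = φ x + φ y)
    (hmul : ∀ c, ∀ x ∈ K, φ (c * x) = c ^ p * φ x)
    (hmem : ∀ x ∈ K, φ x ∈ K)
    (hpφ : ∀ x ∈ K, (p : C) * φ x = 0)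
    (hφφ : ∀ x ∈ K, φ (φ x) = 0) :
    ∃ δ : DividedPowers K, ∀ x ∈ K, δ.dpow p x = φ x := by
  classical
  have hp2 := hp.out.two_le
  have hp0 : p ≠ 0 := by omega
  have hp1 : p ≠ 1 := by omega
  let dp : ℕ → C → C := fun n x => if x ∈ K then
    (if n = 0 then 1 else if n = 1 then x else if n = p then φ x else 0) else 0
  have d0 : ∀ x ∈ K, dp 0 x = 1 := fun x hx => by simp [dp, hx]
  have d1 : ∀ x ∈ K, dp 1 x = x := fun x hx => by simp [dp, hx]
  have dpp : ∀ x ∈ K, dp p x = φ x := fun x hx => by simp [dp, hx, hp0, hp1]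
  have dn : ∀ x, ∀ n, n ≠ 0 → n ≠ 1 → n ≠ p → dp n x = 0 := fun x n h0 h1 h2 => by
    simp [dp, h0, h1, h2]
  have dm : ∀ n x, n ≠ 0 → x ∈ K → dp n x ∈ K := by
    intro n x hn hx
    by_cases h1 : n = 1
    · subst h1; rw [d1 x hx]; exact hx
    · by_cases h2 : n = p
      · rw [h2, dpp x hx]; exact hmem x hx
      · rw [dn x n hn h1 h2]; exact K.zero_mem
  refine ⟨⟨dp, fun {n x} hx => by simp [dp, hx], fun {x} => d0 x, fun {x} => d1 x,
    fun {n x} => dm n x, ?_, ?_, ?_, ?_⟩, dpp⟩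
  · intro n x y hx hy
    have hxy := K.add_mem hx hy
    rcases Nat.eq_zero_or_pos n with rfl | hn
    · simp [d0 _ hx, d0 _ hy, d0 _ hxy]
    obtain ⟨m, rfl⟩ : ∃ m, n = m + 1 := ⟨n - 1, by omega⟩
    have hsum : ∑ k ∈ antidiagonal (m+1), dp k.1 x * dp k.2 y = dp (m+1) x + dp (m+1) y := by
      rw [Finset.Nat.sum_antidiagonal_eq_sum_range_succ (fun i j => dp i x * dp j y),
        Finset.sum_range_succ, Finset.sum_range_succ']
      rw [Finset.sum_eq_zero]
      · simp [d0 _ hx, d0 _ hy, add_comm]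
      · intro i hi
        rw [Finset.mem_range] at hi
        exact hsq _ (dm _ _ (by omega) hx) _ (dm _ _ (by omega) hy)
    rw [hsum]
    by_cases h1 : m + 1 = 1
    · rw [h1, d1 _ hx, d1 _ hy, d1 _ hxy]
    · by_cases h2 : m + 1 = p
      · rw [h2, dpp _ hx, dpp _ hy, dpp _ hxy, hadd x hx y hy]
      · simp [dn _ _ (Nat.succ_ne_zero m) h1 h2]
  · intro n a x hx
    have hax := K.mul_mem_left a hx
    by_cases h0 : n = 0
    · subst h0; simp [d0 _ hx, d0 _ hax]
    by_cases h1 : n = 1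
    · subst h1; simp [d1 _ hx, d1 _ hax]
    by_cases h2 : n = p
    · rw [h2, dpp _ hx, dpp _ hax, hmul a x hx]
    · simp [dn _ _ h0 h1 h2]
  · intro m n x hx
    by_cases hm : m = 0
    · subst hm; simp [d0 _ hx]
    by_cases hn : n = 0
    · subst hn; simp [d0 _ hx]
    rw [hsq _ (dm _ _ hm hx) _ (dm _ _ hn hx)]
    by_cases h2 : m + n = p
    · have : p ∣ (m + n).choose m := by
        rw [h2]; exact hp.out.dvd_choose_self hm (by omega)
      obtain ⟨c, hc⟩ := this
      rw [hc, h2, dpp _ hx]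
      push_cast
      rw [mul_right_comm, hpφ x hx, zero_mul]
    · rw [dn _ _ (by omega) (by omega) h2, mul_zero]
  · intro m n x hn hx
    have hnx := dm n x hn hx
    by_cases hm : m = 0
    · subst hm; simp [d0 _ hx, d0 _ hnx, Nat.uniformBell_zero_left]
    by_cases hm1 : m = 1
    · subst hm1; simp [d1 _ hnx, Nat.uniformBell_one_left]
    by_cases hn1 : n = 1
    · subst hn1; simp [d1 _ hx, Nat.uniformBell_one_right]
    have hmn : m * n ≠ p := by
      intro h
      have := hp.out
      rw [← h] at this
      exact Nat.not_prime_mul hm1 hn1 this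
    have hmn1 : m * n ≠ 1 := by
      intro h
      exact hm1 (Nat.eq_one_of_mul_eq_one_right h)
    rw [dn x (m * n) (Nat.mul_ne_zero hm hn) hmn1 hmn, mul_zero]
    have φ0 : φ 0 = 0 := by
      have := hmul 0 0 K.zero_mem
      simpa [hp0] using this
    by_cases h2 : m = p
    · rw [h2, dpp _ hnx]
      by_cases h3 : n = p
      · rw [h3, dpp _ hx, hφφ x hx]
      · rw [dn _ _ hn hn1 h3, φ0]
    · exact dn _ _ hm hm1 h2

theorem test_ring (p : ℕ) [hp : Fact p.Prime] (W : Type) [CommRing W]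
    (ξ : W) (hξreg : ∀ x : W, ξ * x = 0 → x = 0) :
    ∃ (C : Type) (_ : CommRing C) (K : Ideal C) (δC : DividedPowers K) (g : W →+* C)
      (s : C →+ W ⧸ Ideal.span {(p : W), ξ}), g ξ ∈ K ∧
      (∀ c, s (p * c) = 0) ∧ ∀ y : W, s (g y * δC.dpow p (g ξ)) = Ideal.Quotient.mk _ y := by
  classical
  let I1 : Ideal W := Ideal.span {ξ ^ 2}
  let I2 : Ideal W := Ideal.span {(p : W), ξ}
  have hξ2 : ξ ∈ I2 := Ideal.subset_span (by simp)
  have hp2 : (p : W) ∈ I2 := Ideal.subset_span (by simp)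
  have h12 : I1 ≤ I2 := by
    rw [Ideal.span_singleton_le_iff_mem, pow_two]
    exact I2.mul_mem_left _ hξ2
  let R := W ⧸ I1
  let M := W ⧸ I2
  let _ : Algebra R M := (Ideal.Quotient.factor h12).toAlgebra
  let _ : Module Rᵐᵒᵖ M := Module.compHom M ((RingHom.id R).fromOpposite mul_comm)
  have _ : IsCentralScalar R M := ⟨fun _ _ => rfl⟩
  have hsmul : ∀ (a : W) (m : M), (Ideal.Quotient.mk I1 a) • m = Ideal.Quotient.mk I2 a * m := by
    intro a m
    rw [Algebra.smul_def]; rfl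
  have hpM : (p : M) = 0 := by
    have : Ideal.Quotient.mk I2 (p : W) = 0 := Ideal.Quotient.eq_zero_iff_mem.2 hp2
    simpa using this
  let C := TrivSqZeroExt R M
  let K : Ideal C := Ideal.comap (TrivSqZeroExt.fstHom R R M).toRingHom
    (Ideal.span {Ideal.Quotient.mk I1 ξ})
  have hK : ∀ c : C, c ∈ K ↔ ∃ a : W, c.fst = Ideal.Quotient.mk I1 (ξ * a) := by
    intro c
    rw [Ideal.mem_comap, Ideal.mem_span_singleton']
    constructor
    · rintro ⟨a, ha⟩
      obtain ⟨a, rfl⟩ := Ideal.Quotient.mk_surjective a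
      refine ⟨a, ?_⟩
      rw [mul_comm, map_mul]; exact ha.symm
    · rintro ⟨a, ha⟩
      refine ⟨Ideal.Quotient.mk I1 a, ?_⟩
      rw [mul_comm, ← map_mul]; exact ha.symm
  have hex : ∀ c : C, ∃ a : W, c ∈ K → c.fst = Ideal.Quotient.mk I1 (ξ * a) := by
    intro c
    by_cases hc : c ∈ K
    · obtain ⟨a, ha⟩ := (hK c).1 hc
      exact ⟨a, fun _ => ha⟩
    · exact ⟨0, fun h => absurd h hc⟩
  choose α hα using hex
  have wd : ∀ c ∈ K, ∀ a : W, c.fst = Ideal.Quotient.mk I1 (ξ * a) →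
      Ideal.Quotient.mk I2 (α c) = Ideal.Quotient.mk I2 a := by
    intro c hc a ha
    have h := (hα c hc).symm.trans ha
    rw [Ideal.Quotient.eq, Ideal.mem_span_singleton'] at h
    obtain ⟨t, ht⟩ := h
    rw [Ideal.Quotient.eq]
    have : α c - a - ξ * t = 0 := hξreg _ (by linear_combination -ht)
    have h3 : α c - a = t * ξ := by linear_combination this
    rw [h3]
    exact I2.mul_mem_left _ hξ2
  let φ : C → C := fun c => TrivSqZeroExt.inr (Ideal.Quotient.mk I2 (α c) ^ p)
  have hφ : ∀ c ∈ K, ∀ a : W, c.fst = Ideal.Quotient.mk I1 (ξ * a) →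
      φ c = TrivSqZeroExt.inr (Ideal.Quotient.mk I2 a ^ p) := by
    intro c hc a ha
    simp only [φ, wd c hc a ha]
  have hinr : ∀ m : M, (TrivSqZeroExt.inr m : C) ∈ K := by
    intro m
    rw [hK]
    exact ⟨0, by simp⟩
  obtain ⟨δC, hδ⟩ := pd_twist p K (by
      intro x hx y hy
      have hx' := hα x hx
      have hy' := hα y hy
      have h0 : Ideal.Quotient.mk I2 ξ = 0 := Ideal.Quotient.eq_zero_iff_mem.2 hξ2
      apply TrivSqZeroExt.ext
      · rw [TrivSqZeroExt.fst_mul, hx', hy', ← map_mul, TrivSqZeroExt.fst_zero,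
          Ideal.Quotient.eq_zero_iff_mem, Ideal.mem_span_singleton']
        exact ⟨α x * α y, by ring⟩
      · rw [TrivSqZeroExt.snd_mul, hx', hy', op_smul_eq_smul, hsmul, hsmul, map_mul, map_mul, h0]
        simp) φ
    (by
      intro x hx y hy
      rw [hφ (x + y) (K.add_mem hx hy) (α x + α y)
        (by rw [TrivSqZeroExt.fst_add, hα x hx, hα y hy, ← map_add, mul_add])]
      simp only [φ]
      rw [← TrivSqZeroExt.inr_add]
      congr 1
      obtain ⟨r, hr⟩ := exists_add_pow_prime_eq hp.out (Ideal.Quotient.mk I2 (α x))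
        (Ideal.Quotient.mk I2 (α y))
      rw [map_add, hr]
      have : (p : W ⧸ I2) = 0 := hpM
      rw [this]; simp)
    (by
      intro c x hx
      obtain ⟨b, hb⟩ := Ideal.Quotient.mk_surjective c.fst
      rw [hφ (c * x) (K.mul_mem_left _ hx) (b * α x)
        (by rw [TrivSqZeroExt.fst_mul, hα x hx, ← hb, ← map_mul, mul_left_comm])]
      simp only [φ]
      have hfp : (c ^ p).fst = c.fst ^ p := map_pow (TrivSqZeroExt.fstHom R R M) c p
      apply TrivSqZeroExt.ext
      · rw [TrivSqZeroExt.fst_mul]; simp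
      · rw [TrivSqZeroExt.snd_mul]
        simp only [TrivSqZeroExt.snd_inr, TrivSqZeroExt.fst_inr]
        rw [hfp, ← hb, ← map_pow (Ideal.Quotient.mk I1), hsmul]
        simp [mul_pow])
    (fun x hx => hinr _)
    (by
      intro x hx
      simp only [φ]
      apply TrivSqZeroExt.ext
      · rw [TrivSqZeroExt.fst_mul]; simp
      · rw [← nsmul_eq_mul, TrivSqZeroExt.snd_smul, nsmul_eq_mul, hpM]
        simp)
    (by
      intro x hx
      rw [hφ (φ x) (hinr _) 0 (by simp [φ])]
      simp [hp.out.ne_zero])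
  let g : W →+* C := (TrivSqZeroExt.inlHom R M).comp (Ideal.Quotient.mk I1)
  have hgK : g ξ ∈ K := by
    rw [hK]; exact ⟨1, by simp [g]⟩
  refine ⟨C, inferInstance, K, δC, g,
    ⟨⟨fun c => TrivSqZeroExt.snd c, TrivSqZeroExt.snd_zero⟩, TrivSqZeroExt.snd_add⟩, hgK, ?_, ?_⟩
  · intro c
    change TrivSqZeroExt.snd ((p : C) * c) = 0
    rw [← nsmul_eq_mul, TrivSqZeroExt.snd_smul, nsmul_eq_mul, hpM, zero_mul]
  · intro y
    change TrivSqZeroExt.snd (g y * δC.dpow p (g ξ)) = Ideal.Quotient.mk I2 y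
    rw [hδ _ hgK, hφ (g ξ) hgK 1 (by simp [g]), TrivSqZeroExt.snd_mul]
    simp only [TrivSqZeroExt.snd_inr, TrivSqZeroExt.fst_inr]
    have : (g y).fst = Ideal.Quotient.mk I1 y := rfl
    rw [this, hsmul]
    simp

theorem xi_regular (p : ℕ) [hp : Fact p.Prime]
    (W : Type) [CommRing W]
    [CharP (W ⧸ Ideal.span {(p : W)}) p]
    (hWperf : Function.Bijective (frobenius (W ⧸ Ideal.span {(p : W)}) p))
    (ξ : W) (hξreg : ∀ x : W, ξ * x = 0 → x = 0)
    (D : Type) [CommRing D] [Algebra W D]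
    (J : Ideal D) (δ : DividedPowers J)
    (hξJ : algebraMap W D ξ ∈ J)
    (hDtf : ∀ x : D, (p : D) * x = 0 → x = 0)
    (henv : ∀ (C : Type) (_ : CommRing C) (K : Ideal C) (δC : DividedPowers K)
      (g : W →+* C), g ξ ∈ K →
      ∃! h : D →+* C, h.comp (algebraMap W D) = g ∧
        (∀ x ∈ J, h x ∈ K) ∧
        ∀ (m : ℕ) (x : D), x ∈ J → h (δ.dpow m x) = δC.dpow m (h x)) :
    ∀ y : W, (p : W) ∣ ξ * y → (p : W) ∣ y := by
  rintro y ⟨z, hz⟩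
  obtain ⟨C, iC, K, δC, g, s, hgK, hs, hsy⟩ := test_ring p W ξ hξreg
  obtain ⟨h, ⟨hg, hJ, hd⟩, -⟩ := henv C iC K δC g hgK
  have hga : ∀ w, h (algebraMap W D w) = g w := fun w => by rw [← hg]; rfl
  have h1 : ((p - 1).factorial : D) * δ.dpow p (algebraMap W D ξ) * algebraMap W D y ^ p =
      p * (p ^ (p - 2) * algebraMap W D z ^ p) := by
    have hf := δ.factorial_mul_dpow_eq_pow (n := p) hξJ
    have hpf : (p.factorial : D) = p * (p - 1).factorial := by
      rw [← Nat.cast_mul, Nat.mul_factorial_pred hp.out.ne_zero]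
    have hz' : algebraMap W D ξ ^ p * algebraMap W D y ^ p = p ^ p * algebraMap W D z ^ p := by
      rw [← mul_pow, ← mul_pow, ← map_mul, hz]; simp
    have hpp : (p : D) ^ p = p * (p * p ^ (p - 2)) := by
      rw [← pow_succ', ← pow_succ']; congr 1; have := hp.out.two_le; omega
    rw [← sub_eq_zero]
    apply hDtf
    rw [hpf] at hf
    rw [hpp] at hz'
    linear_combination algebraMap W D y ^ p * hf + hz'
  have h2 := congrArg (fun d => s (h d)) h1
  simp only [map_mul, map_pow, map_natCast, hs] at h2
  rw [hga, hd _ _ hξJ, hga] at h2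
  have h3 := hsy ((p - 1).factorial * y ^ p)
  rw [map_mul g, map_pow g, map_natCast g, mul_right_comm, h2, eq_comm, Ideal.Quotient.eq_zero_iff_mem,
    Ideal.mem_span_pair] at h3
  obtain ⟨a, b, hab⟩ := h3
  have hcop : Nat.Coprime (p - 1).factorial p := by
    rw [Nat.coprime_comm, hp.out.coprime_iff_not_dvd, hp.out.dvd_factorial]
    have := hp.out.pos
    omega
  have hbez := Nat.isCoprime_iff_coprime.2 hcop
  obtain ⟨u, v, huv⟩ := hbez
  have huv' : (u : W) * ((p - 1).factorial : W) + v * p = 1 := by exact_mod_cast congrArg (Int.cast : ℤ → W) huv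
  let q := Ideal.Quotient.mk (Ideal.span {(p : W)})
  have hq : ∀ w : W, q w = 0 ↔ (p : W) ∣ w := fun w => by
    rw [Ideal.Quotient.eq_zero_iff_mem, Ideal.mem_span_singleton]
  rw [← hq]
  have hp0 : q (p : W) = 0 := (hq _).2 dvd_rfl
  have red : ∀ x : W ⧸ Ideal.span {(p : W)}, x ^ p = 0 → x = 0 := by
    intro x hx
    apply hWperf.1
    rw [frobenius_def, hx, map_zero]
  have e1 : q ξ * q y = 0 := by rw [← map_mul, hq]; exact ⟨z, hz⟩
  have e2 : q y ^ p = q ξ * q (u * b) := by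
    have : y ^ p = ξ * (u * b) + p * (v * y ^ p + u * a) := by
      linear_combination (-y ^ p) * huv' - u * hab
    rw [← map_pow, this, map_add, map_mul, map_mul _ (p : W), hp0]; simp
  apply red
  rw [e2]
  apply red
  obtain ⟨m, hm⟩ : ∃ m, p = m + 2 := ⟨p - 2, by have := hp.out.two_le; omega⟩
  have powsplit : ∀ x : W ⧸ Ideal.span {(p : W)}, x ^ p = x ^ (m + 2) :=
    fun x => congrArg (fun k => x ^ k) hm
  have e3 : q ξ * q y ^ p = 0 := by
    rw [powsplit, pow_succ', ← mul_assoc, e1, zero_mul]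
  rw [e2] at e3
  rw [show (q ξ * q (u * b)) ^ p = (q ξ * (q ξ * q (u * b))) * (q (u*b) * (q ξ * q (u * b)) ^ m) by
    rw [powsplit]; ring, e3, zero_mul]

theorem tf_abs {S : Type} [CommRing S] (P : S) (r : ℕ → S) (hP : ∀ f : S, P * f = 0 → f = 0)
    (hr : ∀ N g, r N * g ∈ Ideal.span {P} ⊔ Ideal.span (r '' Set.Iio N) →
      g ∈ Ideal.span {P} ⊔ Ideal.span (r '' Set.Iio N)) :
    ∀ f, P * f ∈ Ideal.span (Set.range r) → f ∈ Ideal.span (Set.range r) := by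
  have hfin : ∀ N f, P * f ∈ Ideal.span (r '' Set.Iio N) → f ∈ Ideal.span (r '' Set.Iio N) := by
    intro N
    induction N with
    | zero =>
      intro f hf
      simp at hf ⊢
      exact hP f hf
    | succ N ih =>
      intro f hf
      have himg : r '' Set.Iio (N + 1) = insert (r N) (r '' Set.Iio N) := by
        rw [← Set.image_insert_eq]
        congr 1
        ext x
        simp only [Set.mem_Iio, Set.mem_insert_iff]; omega
      rw [himg, Ideal.mem_span_insert] at hf ⊢
      obtain ⟨a, z, hz, hf⟩ := hf
      have ha : a ∈ Ideal.span {P} ⊔ Ideal.span (r '' Set.Iio N) := by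
        apply hr
        have : r N * a = f * P - z := by linear_combination -hf
        rw [this]
        apply Ideal.sub_mem
        · exact Ideal.mem_sup_left (Ideal.mul_mem_left _ _ (Ideal.mem_span_singleton_self P))
        · exact Ideal.mem_sup_right hz
      rw [Submodule.mem_sup] at ha
      obtain ⟨y, hy, w, hw, rfl⟩ := ha
      rw [Ideal.mem_span_singleton'] at hy
      obtain ⟨b, rfl⟩ := hy
      refine ⟨b, f - b * r N, ih _ ?_, by ring⟩
      have : P * (f - b * r N) = w * r N + z := by linear_combination hf
      rw [this]
      exact Ideal.add_mem _ (Ideal.mul_mem_right _ _ hw) hz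
  have hU : Ideal.span (Set.range r) = ⨆ N, Ideal.span (r '' Set.Iio N) := by
    rw [← Ideal.span_iUnion]
    congr 1
    ext x
    simp only [Set.mem_range, Set.mem_iUnion, Set.mem_image, Set.mem_Iio]
    constructor
    · rintro ⟨i, rfl⟩
      exact ⟨i + 1, i, by omega, rfl⟩
    · rintro ⟨_, i, _, rfl⟩
      exact ⟨i, rfl⟩
  have hdir : Directed (· ≤ ·) (fun N => Ideal.span (r '' Set.Iio N)) := by
    apply Monotone.directed_le
    intro a b hab
    exact Ideal.span_mono (Set.image_mono (Set.Iio_subset_Iio hab))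
  intro f hf
  rw [hU, Submodule.mem_iSup_of_directed _ hdir] at hf ⊢
  obtain ⟨N, hN⟩ := hf
  exact ⟨N, hfin N f hN⟩

open MvPolynomial in
theorem X_regular {W : Type} [CommRing W] (m : ℕ) (G : Set (MvPolynomial ℕ W))
    (hG : ∀ l ∈ G, ∀ a, (a * l).divMonomial (Finsupp.single m 1) =
      a.divMonomial (Finsupp.single m 1) * l) (f : MvPolynomial ℕ W)
    (hf : X m * f ∈ Ideal.span G) : f ∈ Ideal.span G := by
  have key : ∀ g ∈ Ideal.span G, g.divMonomial (Finsupp.single m 1) ∈ Ideal.span G := by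
    intro g hg
    rw [Ideal.span, ← Set.image_id G] at hg
    induction hg using Submodule.span_induction with
    | mem x h =>
      simp only [id, Set.image_id'] at h
      have := hG x h 1
      rw [one_mul] at this
      rw [this]
      exact Ideal.mul_mem_left _ _ (Ideal.subset_span h)
    | zero => rw [zero_divMonomial]; exact Ideal.zero_mem _
    | add x y hx hy ihx ihy => rw [add_divMonomial]; exact Ideal.add_mem _ ihx ihy
    | smul a x hx ih =>
      clear ih
      rw [Set.image_id] at hx
      induction hx using Submodule.span_induction generalizing a with
      | mem x h =>
        rw [smul_eq_mul, hG x h a]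
        exact Ideal.mul_mem_left _ _ (Ideal.subset_span h)
      | zero => rw [smul_zero, zero_divMonomial]; exact Ideal.zero_mem _
      | add x y hx hy ihx ihy =>
        rw [smul_add, add_divMonomial]; exact Ideal.add_mem _ (ihx a) (ihy a)
      | smul b x hx ih => rw [smul_smul]; exact ih _
  have := key _ hf
  rwa [X_mul_divMonomial] at this

open MvPolynomial in
theorem mv_tf {W : Type} [CommRing W] (p : ℕ) [hp : Fact p.Prime] (ξ : W)
    (hWtf : ∀ x : W, (p : W) * x = 0 → x = 0)
    (hreg : ∀ y : W, (p : W) ∣ ξ * y → (p : W) ∣ y)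
    (r : ℕ → MvPolynomial ℕ W) (hr0 : r 0 = (p : MvPolynomial ℕ W) * X 0 - C (ξ ^ p))
    (hrs : ∀ m, r (m + 1) = (p : MvPolynomial ℕ W) * X (m + 1) - X m ^ p) :
    ∀ f, (p : MvPolynomial ℕ W) * f ∈ Ideal.span (Set.range r) → f ∈ Ideal.span (Set.range r) := by
  have hpC : (p : MvPolynomial ℕ W) = C (p : W) := by simp
  apply tf_abs
  · intro f hf
    ext m
    rw [hpC] at hf
    have := congrArg (coeff m) hf
    rw [coeff_C_mul, coeff_zero] at this
    rw [coeff_zero]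
    exact hWtf _ this
  · intro N
    cases N with
    | zero =>
      intro g hg
      simp only [Set.Iio_zero_eq_empty, Set.image_empty, Ideal.span_empty, sup_bot_eq] at hg ⊢
      rw [Ideal.mem_span_singleton] at hg ⊢
      have h1 : (p : MvPolynomial ℕ W) ∣ C (ξ ^ p) * g := by
        have : C (ξ ^ p) * g = (p : MvPolynomial ℕ W) * (X 0 * g) - r 0 * g := by rw [hr0]; ring
        rw [this]
        exact dvd_sub (dvd_mul_right _ _) hg
      rw [hpC, C_dvd_iff_dvd_coeff] at h1 ⊢
      intro i
      have h2 := h1 i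
      rw [coeff_C_mul] at h2
      have : ∀ k : ℕ, (p : W) ∣ ξ ^ k * coeff i g → (p : W) ∣ coeff i g := by
        intro k
        induction k with
        | zero => simp
        | succ k ih =>
          intro h
          apply ih
          apply hreg
          rwa [← mul_assoc, ← pow_succ']
      exact this p h2
    | succ N =>
      set G : Set (MvPolynomial ℕ W) := {C (p : W), C (ξ ^ p)} ∪ (fun j => X j ^ p) '' Set.Iio N with hGdef
      have hLG : Ideal.span {(p : MvPolynomial ℕ W)} ⊔ Ideal.span (r '' Set.Iio (N + 1))
          = Ideal.span G := by
        have hpG : (p : MvPolynomial ℕ W) ∈ Ideal.span G := by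
          rw [hpC]; exact Ideal.subset_span (by simp [G])
        apply le_antisymm
        · apply sup_le
          · rw [Ideal.span_singleton_le_iff_mem]; exact hpG
          · rw [Ideal.span_le]
            rintro _ ⟨j, hj, rfl⟩
            rw [Set.mem_Iio] at hj
            cases j with
            | zero =>
              rw [hr0]
              exact Ideal.sub_mem _ (Ideal.mul_mem_right _ _ hpG) (Ideal.subset_span (by simp [G]))
            | succ j =>
              rw [hrs]
              exact Ideal.sub_mem _ (Ideal.mul_mem_right _ _ hpG)
                (Ideal.subset_span (Or.inr ⟨j, by rw [Set.mem_Iio]; omega, rfl⟩))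
        · rw [Ideal.span_le]
          have hpL : (p : MvPolynomial ℕ W) ∈ Ideal.span {(p : MvPolynomial ℕ W)} ⊔
              Ideal.span (r '' Set.Iio (N + 1)) :=
            Ideal.mem_sup_left (Ideal.mem_span_singleton_self _)
          have hrL : ∀ j, j < N + 1 → r j ∈ Ideal.span {(p : MvPolynomial ℕ W)} ⊔
              Ideal.span (r '' Set.Iio (N + 1)) := fun j hj =>
            Ideal.mem_sup_right (Ideal.subset_span ⟨j, hj, rfl⟩)
          rintro x ((rfl | rfl) | ⟨j, hj, rfl⟩)
          · rw [← hpC]; exact hpL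
          · have : C (ξ ^ p) = (p : MvPolynomial ℕ W) * X 0 - r 0 := by rw [hr0]; ring
            rw [this]
            exact Ideal.sub_mem _ (Ideal.mul_mem_right _ _ hpL) (hrL 0 (by omega))
          · rw [Set.mem_Iio] at hj
            have : X j ^ p = (p : MvPolynomial ℕ W) * X (j + 1) - r (j + 1) := by rw [hrs]; ring
            simp only
            rw [this]
            exact Ideal.sub_mem _ (Ideal.mul_mem_right _ _ hpL) (hrL (j + 1) (by omega))
      have hG : ∀ l ∈ G, ∀ a, (a * l).divMonomial (Finsupp.single N 1) =
          a.divMonomial (Finsupp.single N 1) * l := by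
        have hC : ∀ (t : W) (a : MvPolynomial ℕ W), (a * C t).divMonomial (Finsupp.single N 1) =
          a.divMonomial (Finsupp.single N 1) * C t := by
          intro t a
          ext s
          rw [mul_comm, mul_comm _ (C t), coeff_C_mul, coeff_divMonomial, coeff_divMonomial, coeff_C_mul]
        rintro x ((rfl | rfl) | ⟨j, hj, rfl⟩) a
        · exact hC _ a
        · exact hC _ a
        · rw [Set.mem_Iio] at hj
          simp only
          ext s
          rw [coeff_divMonomial, X_pow_eq_monomial, coeff_mul_monomial', coeff_mul_monomial',
            coeff_divMonomial]
          have hiff : Finsupp.single j p ≤ Finsupp.single N 1 + s ↔ Finsupp.single j p ≤ s := by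
            rw [Finsupp.single_le_iff, Finsupp.single_le_iff, Finsupp.add_apply,
              Finsupp.single_apply, if_neg (by omega), zero_add]
          by_cases h : Finsupp.single j p ≤ s
          · rw [if_pos h, if_pos (hiff.2 h), add_tsub_assoc_of_le h]
          · rw [if_neg h, if_neg (fun h' => h (hiff.1 h'))]
      rw [hLG]
      intro g hg
      have h1 : X N ^ p * g ∈ Ideal.span G := by
        have : X N ^ p * g = C (p : W) * (X (N + 1) * g) - r (N + 1) * g := by
          rw [hrs, hpC]; ring
        rw [this]
        exact Ideal.sub_mem _ (Ideal.mul_mem_right _ _ (Ideal.subset_span (by simp [G]))) hg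
      have : ∀ k : ℕ, X N ^ k * g ∈ Ideal.span G → g ∈ Ideal.span G := by
        intro k
        induction k with
        | zero => simp
        | succ k ih =>
          intro h
          apply ih
          apply X_regular N G hG
          rwa [← mul_assoc, ← pow_succ']
      exact this p h1

end AcrisAux

namespace AcrisAux

theorem exists_loc (p : ℕ) (R : Type) [CommRing R] :
    ∃ (R' : Type) (_ : CommRing R') (ι : R →+* R'),
      (∀ k : ℕ, p.Coprime k → IsUnit (k : R')) ∧
      ((∀ x : R, (p : R) * x = 0 → x = 0) → ∀ x : R', (p : R') * x = 0 → x = 0) ∧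
      (∀ (T : Type) (_ : CommRing T) (f : R →+* T), (∀ k : ℕ, p.Coprime k → IsUnit (k : T)) →
        ∃ f' : R' →+* T, f'.comp ι = f) ∧
      (∀ (T : Type) (_ : CommRing T) (f g : R' →+* T), f.comp ι = g.comp ι → f = g) := by
  let M : Submonoid R :=
    { carrier := {x | ∃ k : ℕ, p.Coprime k ∧ (k : R) = x}
      one_mem' := ⟨1, by simp, by simp⟩
      mul_mem' := by
        rintro _ _ ⟨a, ha, rfl⟩ ⟨b, hb, rfl⟩
        exact ⟨a * b, Nat.Coprime.mul_right ha hb, by simp⟩ }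
  refine ⟨Localization M, inferInstance, algebraMap R (Localization M), ?_, ?_, ?_, ?_⟩
  · intro k hk
    have := IsLocalization.map_units (Localization M) (⟨(k : R), k, hk, rfl⟩ : M)
    simpa using this
  · intro h x hx
    obtain ⟨a, s, rfl⟩ := IsLocalization.exists_mk'_eq M x
    have h1 : IsLocalization.mk' (Localization M) ((p : R) * a) s = 0 := by
      rw [← hx, ← IsLocalization.mul_mk'_eq_mk'_of_mul, map_natCast]
    rw [IsLocalization.mk'_eq_zero_iff] at h1 ⊢
    obtain ⟨m, hm⟩ := h1
    refine ⟨m, h _ ?_⟩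
    rw [← hm]; ring
  · intro T _ f hf
    have hM : ∀ y : M, IsUnit (f y) := by
      rintro ⟨_, k, hk, rfl⟩
      simpa using hf k hk
    exact ⟨IsLocalization.lift hM, IsLocalization.lift_comp hM⟩
  · intro T _ f g hfg
    exact IsLocalization.ringHom_ext M hfg

theorem fact_reg (p : ℕ) [hp : Fact p.Prime] (R : Type) [CommRing R]
    (htf : ∀ x : R, (p : R) * x = 0 → x = 0)
    (hu : ∀ k : ℕ, p.Coprime k → IsUnit (k : R)) (k : ℕ) (x y : R)
    (h : (k.factorial : R) * x = k.factorial * y) : x = y := by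
  obtain ⟨v, c, hc, hk⟩ := Nat.exists_eq_pow_mul_and_not_dvd (Nat.factorial_ne_zero k) p hp.out.ne_one
  rw [hk] at h
  have hcu := hu c ((hp.out.coprime_iff_not_dvd).2 hc)
  have key : ∀ (v : ℕ) (z : R), (p : R) ^ v * z = 0 → z = 0 := by
    intro v
    induction v with
    | zero => intro z hz; simpa using hz
    | succ v ih =>
      intro z hz
      apply ih
      apply htf
      rw [← mul_assoc, ← pow_succ']; exact hz
  rw [← sub_eq_zero]
  have h2 : (c : R) * (x - y) = 0 := by
    apply key v
    push_cast at h
    linear_combination h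
  exact (hcu.mul_right_eq_zero).1 h2

theorem unit_mod (p n : ℕ) (T : Type) [CommRing T] (hT : (p : T) ^ n = 0) (k : ℕ)
    (hk : p.Coprime k) : IsUnit (k : T) := by
  have h1 : IsCoprime ((p ^ n : ℕ) : ℤ) (k : ℤ) := Nat.isCoprime_iff_coprime.2 (hk.pow_left n)
  obtain ⟨u, v, huv⟩ := h1
  have h2 : (u : T) * (p : T) ^ n + v * k = 1 := by
    exact_mod_cast congrArg (Int.cast : ℤ → T) huv
  rw [hT, mul_zero, zero_add] at h2
  exact IsUnit.of_mul_eq_one (v : T) (by rw [mul_comm]; exact h2)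

theorem gamma_facts (p : ℕ) [hp : Fact p.Prime] {D : Type} [CommRing D] {J : Ideal D}
    (δ : DividedPowers J) (x : D) (hx : x ∈ J) :
    (∀ m, gammaIter δ p x m ∈ J) ∧ (p : D) * gammaIter δ p x 0 = x ^ p ∧
      ∀ m, (p : D) * gammaIter δ p x (m + 1) = gammaIter δ p x m ^ p := by
  have hp0 := hp.out.ne_zero
  have key : ∀ y ∈ J, (p : D) * (((p - 1).factorial : D) * δ.dpow p y) = y ^ p := by
    intro y hy
    rw [← δ.factorial_mul_dpow_eq_pow hy, ← mul_assoc, ← Nat.cast_mul,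
      Nat.mul_factorial_pred hp0]
  have hJ : ∀ m, gammaIter δ p x m ∈ J := by
    intro m
    induction m with
    | zero => exact J.mul_mem_left _ (δ.dpow_mem hp0 hx)
    | succ m ih => exact J.mul_mem_left _ (δ.dpow_mem hp0 ih)
  exact ⟨hJ, key x hx, fun m => key _ (hJ m)⟩

end AcrisAux

theorem acris_mod_pn_presentation
    (p : ℕ) [Fact p.Prime] (hp : 2 < p) (n : ℕ) (hn : 1 ≤ n)
    -- `W = W(R̄^♭)`: `p`-torsion free and perfect modulo `p`
    (W : Type) [CommRing W]
    [CharP (W ⧸ Ideal.span {(p : W)}) p]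
    (hWtf : ∀ x : W, (p : W) * x = 0 → x = 0)
    (hWperf : Function.Bijective (frobenius (W ⧸ Ideal.span {(p : W)}) p))
    -- `ξ` a nonzerodivisor (generating `ker θ`)
    (ξ : W) (hξreg : ∀ x : W, ξ * x = 0 → x = 0)
    -- `D`, the divided power envelope of `W` along `(ξ)`, `p`-torsion free
    (D : Type) [CommRing D] [Algebra W D]
    (J : Ideal D) (δ : DividedPowers J)
    (hξJ : algebraMap W D ξ ∈ J)
    (hDtf : ∀ x : D, (p : D) * x = 0 → x = 0)
    (henv : ∀ (C : Type) (_ : CommRing C) (K : Ideal C) (δC : DividedPowers K)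
      (g : W →+* C), g ξ ∈ K →
      ∃! h : D →+* C, h.comp (algebraMap W D) = g ∧
        (∀ x ∈ J, h x ∈ K) ∧
        ∀ (m : ℕ) (x : D), x ∈ J → h (δ.dpow m x) = δC.dpow m (h x)) :
    ∃ e : (MvPolynomial ℕ (W ⧸ Ideal.span {(p : W) ^ n}) ⧸
        Ideal.span
          ({(p : MvPolynomial ℕ (W ⧸ Ideal.span {(p : W) ^ n})) * MvPolynomial.X 0
              - MvPolynomial.C
                ((Ideal.Quotient.mk (Ideal.span {(p : W) ^ n}) ξ) ^ p)} ∪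
            Set.range (fun m : ℕ =>
              (p : MvPolynomial ℕ (W ⧸ Ideal.span {(p : W) ^ n}))
                  * MvPolynomial.X (m + 1) - (MvPolynomial.X m) ^ p)))
        ≃+* (D ⧸ Ideal.span {(p : D) ^ n}),
      ∀ m : ℕ,
        e (Ideal.Quotient.mk _ (MvPolynomial.X m))
          = Ideal.Quotient.mk (Ideal.span {(p : D) ^ n})
              (gammaIter δ p (algebraMap W D ξ) m) := by
  classical
  have hp' : Fact p.Prime := inferInstance
  have hreg := AcrisAux.xi_regular p W hWperf ξ hξreg D J δ hξJ hDtf henv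
  obtain ⟨γJ, γ0, γs⟩ := AcrisAux.gamma_facts p δ (algebraMap W D ξ) hξJ
  set γ := gammaIter δ p (algebraMap W D ξ) with hγdef
  -- the integral presentation
  let r : ℕ → MvPolynomial ℕ W := fun m => Nat.casesOn m
    ((p : MvPolynomial ℕ W) * MvPolynomial.X 0 - MvPolynomial.C (ξ ^ p))
    (fun m => (p : MvPolynomial ℕ W) * MvPolynomial.X (m + 1) - MvPolynomial.X m ^ p)
  have hr0 : r 0 = (p : MvPolynomial ℕ W) * MvPolynomial.X 0 - MvPolynomial.C (ξ ^ p) := rfl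
  have hrs : ∀ m, r (m + 1) = (p : MvPolynomial ℕ W) * MvPolynomial.X (m + 1)
    - MvPolynomial.X m ^ p := fun _ => rfl
  have hmv := AcrisAux.mv_tf p ξ hWtf hreg r hr0 hrs
  let I := Ideal.span (Set.range r)
  have hrI : ∀ m, Ideal.Quotient.mk I (r m) = 0 := fun m =>
    Ideal.Quotient.eq_zero_iff_mem.2 (Ideal.subset_span ⟨m, rfl⟩)
  have hAtf : ∀ x : MvPolynomial ℕ W ⧸ I, (p : MvPolynomial ℕ W ⧸ I) * x = 0 → x = 0 := by
    intro x hx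
    obtain ⟨f, rfl⟩ := Ideal.Quotient.mk_surjective x
    rw [← map_natCast (Ideal.Quotient.mk I), ← map_mul, Ideal.Quotient.eq_zero_iff_mem] at hx
    exact Ideal.Quotient.eq_zero_iff_mem.2 (hmv f hx)
  -- localize away from the other primes
  obtain ⟨A', iA, ιA, uA, tfA, liftA, extA⟩ := AcrisAux.exists_loc p (MvPolynomial ℕ W ⧸ I)
  obtain ⟨D', iD, ιD, uD, tfD, liftD, extD⟩ := AcrisAux.exists_loc p D
  replace tfA := tfA hAtf
  replace tfD := tfD hDtf
  have regA := AcrisAux.fact_reg p A' tfA uA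
  have regD := AcrisAux.fact_reg p D' tfD uD
  -- divided powers on `A'`
  let gA : W →+* A' := ιA.comp ((Ideal.Quotient.mk I).comp MvPolynomial.C)
  let s : ℕ → A' := fun m => Nat.casesOn m (gA ξ)
    (fun m => ιA (Ideal.Quotient.mk I (MvPolynomial.X m)))
  have hs : ∀ m, (p : A') * s (m + 1) = s m ^ p := by
    intro m
    have h := congrArg ιA (hrI m)
    cases m with
    | zero =>
      rw [hr0] at h
      simp only [map_sub, map_mul, map_pow, map_natCast, map_zero] at h
      exact sub_eq_zero.1 h
    | succ m =>
      rw [hrs] at h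
      simp only [map_sub, map_mul, map_pow, map_natCast, map_zero] at h
      exact sub_eq_zero.1 h
  let KA : Ideal A' := Ideal.span (Set.range s)
  have hsK : ∀ m, s m ∈ KA := fun m => Ideal.subset_span ⟨m, rfl⟩
  obtain ⟨δA⟩ := AcrisAux.pd_of_divisible KA regA (AcrisAux.div_of_span KA (Set.range s) rfl (by
    rintro _ ⟨m, rfl⟩ k hk
    exact AcrisAux.div_of_seq p KA s hsK hs uA k hk m))
  obtain ⟨h, ⟨hg, hJK, -⟩, -⟩ := henv A' iA KA δA gA (hsK 0)
  have hga : ∀ w, h (algebraMap W D w) = gA w := fun w => by rw [← hg]; rfl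
  have cancelA : ∀ x y : A', (p : A') * x = p * y → x = y := by
    intro x y hxy
    rw [← sub_eq_zero]
    apply tfA
    rw [mul_sub, hxy, sub_self]
  have hγ : ∀ m, h (γ m) = s (m + 1) := by
    intro m
    induction m with
    | zero =>
      apply cancelA
      rw [hs, ← map_natCast h, ← map_mul, γ0, map_pow, hga]
      rfl
    | succ m ih =>
      apply cancelA
      rw [hs, ← map_natCast h, ← map_mul, γs, map_pow, ih]
  -- divided powers on `D'`
  let KD : Ideal D' := Ideal.map ιD J
  obtain ⟨δD⟩ := AcrisAux.pd_of_divisible KD regD (AcrisAux.div_of_span KD (ιD '' J) rfl (by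
    rintro _ ⟨x, hx, rfl⟩ k hk
    refine ⟨ιD (δ.dpow k x), Ideal.mem_map_of_mem _ (δ.dpow_mem hk hx), ?_⟩
    rw [← map_natCast ιD, ← map_mul, δ.factorial_mul_dpow_eq_pow hx, map_pow]))
  have autoPD : ∀ f : D →+* D', (∀ x ∈ J, f x ∈ KD) → ∀ (m : ℕ) (x : D), x ∈ J →
      f (δ.dpow m x) = δD.dpow m (f x) := by
    intro f hf m x hx
    apply regD m
    rw [δD.factorial_mul_dpow_eq_pow (hf x hx), ← map_natCast f, ← map_mul,
      δ.factorial_mul_dpow_eq_pow hx, map_pow]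
  -- the map from the presentation to `D`
  let μ0 : MvPolynomial ℕ W →+* D := MvPolynomial.eval₂Hom (algebraMap W D) γ
  have hμ0 : ∀ f ∈ I, μ0 f = 0 := by
    intro f hf
    have hle : I ≤ RingHom.ker μ0 := by
      rw [Ideal.span_le]
      rintro _ ⟨m, rfl⟩
      rw [SetLike.mem_coe, RingHom.mem_ker]
      cases m with
      | zero => rw [hr0]; simp [μ0, γ0]
      | succ m => rw [hrs]; simp [μ0, γs]
    exact hle hf
  let μ : (MvPolynomial ℕ W ⧸ I) →+* D := Ideal.Quotient.lift I μ0 hμ0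
  obtain ⟨μ', hμ'⟩ := liftA D' iD (ιD.comp μ) uD
  have hμ'a : ∀ x, μ' (ιA x) = ιD (μ x) := fun x => congrArg (fun f => f x) hμ'
  have hμX : ∀ m, μ (Ideal.Quotient.mk I (MvPolynomial.X m)) = γ m := by
    intro m
    simp [μ, μ0]
  have hμC : ∀ w, μ (Ideal.Quotient.mk I (MvPolynomial.C w)) = algebraMap W D w := by
    intro w
    simp [μ, μ0]
  have hμKA : ∀ x ∈ KA, μ' x ∈ KD := by
    intro x hx
    have hle : KA ≤ Ideal.comap μ' KD := by
      rw [Ideal.span_le]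
      rintro _ ⟨m, rfl⟩
      rw [SetLike.mem_coe, Ideal.mem_comap]
      cases m with
      | zero =>
        have : μ' (s 0) = ιD (algebraMap W D ξ) := by
          rw [← hμC]; exact hμ'a _
        rw [this]
        exact Ideal.mem_map_of_mem _ hξJ
      | succ m =>
        have : μ' (s (m + 1)) = ιD (γ m) := by
          rw [← hμX]; exact hμ'a _
        rw [this]
        exact Ideal.mem_map_of_mem _ (γJ m)
    exact hle hx
  have hcomp : μ'.comp h = ιD := by
    obtain ⟨h0, -, huniq⟩ := henv D' iD KD δD (ιD.comp (algebraMap W D))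
      (Ideal.mem_map_of_mem _ hξJ)
    have c1 : ∀ x ∈ J, (μ'.comp h) x ∈ KD := fun x hx => hμKA _ (hJK x hx)
    have c2 : ∀ x ∈ J, ιD x ∈ KD := fun x hx => Ideal.mem_map_of_mem _ hx
    refine (huniq (μ'.comp h) ⟨?_, c1, autoPD _ c1⟩).trans (huniq ιD ⟨rfl, c2, autoPD _ c2⟩).symm
    ext w
    simp only [RingHom.comp_apply]
    rw [hga, ← hμC]
    exact hμ'a _
  -- the quotients
  set Wn := W ⧸ Ideal.span {(p : W) ^ n} with hWn
  set Dn := D ⧸ Ideal.span {(p : D) ^ n} with hDn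
  set In : Ideal (MvPolynomial ℕ Wn) := Ideal.span
          ({(p : MvPolynomial ℕ Wn) * MvPolynomial.X 0
              - MvPolynomial.C
                ((Ideal.Quotient.mk (Ideal.span {(p : W) ^ n}) ξ) ^ p)} ∪
            Set.range (fun m : ℕ =>
              (p : MvPolynomial ℕ Wn)
                  * MvPolynomial.X (m + 1) - (MvPolynomial.X m) ^ p)) with hIn
  let πW : W →+* Wn := Ideal.Quotient.mk (Ideal.span {(p : W) ^ n})
  let πD : D →+* Dn := Ideal.Quotient.mk (Ideal.span {(p : D) ^ n})
  let πn : MvPolynomial ℕ Wn →+* MvPolynomial ℕ Wn ⧸ In := Ideal.Quotient.mk In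
  have hpW : (p : Wn) ^ n = 0 := by
    have : πW ((p : W) ^ n) = 0 :=
      Ideal.Quotient.eq_zero_iff_mem.2 (Ideal.mem_span_singleton_self _)
    simpa using this
  have hpD : (p : Dn) ^ n = 0 := by
    have : πD ((p : D) ^ n) = 0 :=
      Ideal.Quotient.eq_zero_iff_mem.2 (Ideal.mem_span_singleton_self _)
    simpa using this
  have hpAn : (p : MvPolynomial ℕ Wn ⧸ In) ^ n = 0 := by
    have := congrArg (fun x => πn (MvPolynomial.C x)) hpW
    simpa using this
  have uAn := AcrisAux.unit_mod p n (MvPolynomial ℕ Wn ⧸ In) hpAn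
  have uDn := AcrisAux.unit_mod p n Dn hpD
  -- `A' → Aₙ`
  let l0 : MvPolynomial ℕ W →+* MvPolynomial ℕ Wn ⧸ In := πn.comp (MvPolynomial.map πW)
  have hl0 : ∀ f ∈ I, l0 f = 0 := by
    intro f hf
    have hle : I ≤ RingHom.ker l0 := by
      rw [Ideal.span_le]
      rintro _ ⟨m, rfl⟩
      rw [SetLike.mem_coe, RingHom.mem_ker]
      apply Ideal.Quotient.eq_zero_iff_mem.2
      apply Ideal.subset_span
      cases m with
      | zero => left; rw [hr0]; simp [πW]
      | succ m => right; rw [hrs]; exact ⟨m, by simp⟩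
    exact hle hf
  let l : (MvPolynomial ℕ W ⧸ I) →+* MvPolynomial ℕ Wn ⧸ In := Ideal.Quotient.lift I l0 hl0
  have hlX : ∀ m, l (Ideal.Quotient.mk I (MvPolynomial.X m)) = πn (MvPolynomial.X m) := by
    intro m
    simp [l, l0]
  have hlC : ∀ w, l (Ideal.Quotient.mk I (MvPolynomial.C w)) = πn (MvPolynomial.C (πW w)) := by
    intro w
    simp [l, l0]
  obtain ⟨l', hl'⟩ := liftA _ inferInstance l uAn
  have hl'a : ∀ x, l' (ιA x) = l x := fun x => congrArg (fun f => f x) hl'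
  obtain ⟨ν, hν⟩ := liftD Dn inferInstance πD uDn
  have hνa : ∀ x, ν (ιD x) = πD x := fun x => congrArg (fun f => f x) hν
  -- `Dₙ → Aₙ`
  have hψ0 : ∀ d ∈ Ideal.span {(p : D) ^ n}, (l'.comp h) d = 0 := by
    intro d hd
    obtain ⟨c, rfl⟩ := Ideal.mem_span_singleton.1 hd
    rw [map_mul, map_pow, map_natCast, hpAn, zero_mul]
  let ψ : Dn →+* MvPolynomial ℕ Wn ⧸ In := Ideal.Quotient.lift _ (l'.comp h) hψ0
  have hψ : ∀ d, ψ (πD d) = l' (h d) := fun d => Ideal.Quotient.lift_mk _ _ _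
  -- `Aₙ → Dₙ`
  have hf0 : ∀ w ∈ Ideal.span {(p : W) ^ n}, (πD.comp (algebraMap W D)) w = 0 := by
    intro d hd
    obtain ⟨c, rfl⟩ := Ideal.mem_span_singleton.1 hd
    rw [map_mul, map_pow, map_natCast, hpD, zero_mul]
  let f0 : Wn →+* Dn := Ideal.Quotient.lift _ (πD.comp (algebraMap W D)) hf0
  have hf0a : ∀ w, f0 (πW w) = πD (algebraMap W D w) := fun d => Ideal.Quotient.lift_mk _ _ _
  let φ0 : MvPolynomial ℕ Wn →+* Dn := MvPolynomial.eval₂Hom f0 (fun m => πD (γ m))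
  have hφ0 : ∀ f ∈ In, φ0 f = 0 := by
    intro f hf
    have hle : In ≤ RingHom.ker φ0 := by
      rw [hIn, Ideal.span_le]
      rintro _ (rfl | ⟨m, rfl⟩)
      · rw [SetLike.mem_coe, RingHom.mem_ker]
        have := congrArg πD γ0
        simp only [map_mul, map_pow, map_natCast] at this
        simp only [φ0, map_sub, map_mul, map_pow, map_natCast, MvPolynomial.eval₂Hom_X',
          MvPolynomial.eval₂Hom_C]
        rw [this, sub_eq_zero]
        exact congrArg (· ^ p) (hf0a ξ).symm
      · rw [SetLike.mem_coe, RingHom.mem_ker]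
        have := congrArg πD (γs m)
        simp only [map_mul, map_pow, map_natCast] at this
        simp only [φ0, map_sub, map_mul, map_pow, map_natCast, MvPolynomial.eval₂Hom_X']
        rw [this, sub_self]
    exact hle hf
  let φ : (MvPolynomial ℕ Wn ⧸ In) →+* Dn := Ideal.Quotient.lift In φ0 hφ0
  have hφX : ∀ m, φ (πn (MvPolynomial.X m)) = πD (γ m) := by
    intro m
    simp [φ, φ0, πn]
  have hφC : ∀ w, φ (πn (MvPolynomial.C (πW w))) = πD (algebraMap W D w) := by
    intro w
    rw [← hf0a]
    simp [φ, φ0, πn]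
  have hφl : φ.comp l' = ν.comp μ' := by
    apply extA
    apply Ideal.Quotient.ringHom_ext
    apply MvPolynomial.ringHom_ext
    · intro w
      simp only [RingHom.comp_apply]
      rw [hl'a, hlC, hφC, hμ'a, hμC, hνa]
    · intro m
      simp only [RingHom.comp_apply]
      rw [hl'a, hlX, hφX, hμ'a, hμX, hνa]
  refine ⟨RingEquiv.ofRingHom φ ψ ?_ ?_, hφX⟩
  · apply Ideal.Quotient.ringHom_ext
    ext d
    change φ (ψ (πD d)) = πD d
    rw [hψ, ← hνa, ← hcomp]
    exact congrArg (fun f => f (h d)) hφl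
  · apply Ideal.Quotient.ringHom_ext
    apply MvPolynomial.ringHom_ext
    · intro w
      obtain ⟨w, rfl⟩ := Ideal.Quotient.mk_surjective w
      change ψ (φ (πn (MvPolynomial.C (πW w)))) = πn (MvPolynomial.C (πW w))
      rw [hφC, hψ, hga, ← hlC]
      exact hl'a _
    · intro m
      change ψ (φ (πn (MvPolynomial.X m))) = πn (MvPolynomial.X m)
      rw [hφX, hψ, hγ, ← hlX]
      exact hl'a _
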